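/- Let L = LaurentSeries ℝ be the field of formal Laurent series in a variable w (representing z⁻¹), so that z = w⁻¹ ∈ L. Let Φx, Rc be n×n matrices and Φu, Mc be m×n matrices over L that are strictly proper, i.e. every entry has zero coefficient in all degrees k ≤ 0, and suppose the degree-1 coefficient matrix of Rc is the identity, Rc(1) = I. View A ∈ ℝ^{n×n}, B ∈ ℝ^{n×m} as constant matrices over L. If Rc = Φx·Δc and Mc = Φu·Δc, where Δc = (w⁻¹·I − A)·Rc − B·Mc, then the degree-1 coefficient matrices of Mc and Φu are equal: Mc(1) = Φu(1). -/

import Mathlib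

open Matrix

/-- The variable `w` of the field of formal Laurent series, standing for `z⁻¹`. -/
noncomputable def wvar : LaurentSeries ℝ := HahnSeries.single (1 : ℤ) (1 : ℝ)

/-- A transfer matrix over `LaurentSeries ℝ` is strictly proper when every entry has zero
coefficient in all degrees `k ≤ 0`. -/
def StrictlyProper {p q : ℕ} (G : Matrix (Fin p) (Fin q) (LaurentSeries ℝ)) : Prop :=
  ∀ i j, ∀ k : ℤ, k ≤ 0 → (G i j).coeff k = 0

/-- The `k`-th spectral component of a transfer matrix: the entrywise degree-`k`
coefficient matrix. -/
def specComp {p q : ℕ} (k : ℤ) (G : Matrix (Fin p) (Fin q) (LaurentSeries ℝ)) :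
    Matrix (Fin p) (Fin q) ℝ :=
  Matrix.of fun i j => (G i j).coeff k

/-- View a real matrix as a constant matrix over `LaurentSeries ℝ`. -/
noncomputable def liftL {p q : ℕ} (M : Matrix (Fin p) (Fin q) ℝ) :
    Matrix (Fin p) (Fin q) (LaurentSeries ℝ) :=
  M.map (algebraMap ℝ (LaurentSeries ℝ))

/-- If `x` vanishes below degree `a` and `y` below degree `b`, the degree-`a + b` coefficient of
`x * y` is the product of the coefficients of degrees `a` and `b`. -/
theorem coeff_mul_add_of_forall_lt {x y : LaurentSeries ℝ} {a b : ℤ}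
    (hx : ∀ k < a, x.coeff k = 0) (hy : ∀ k < b, y.coeff k = 0) :
    (x * y).coeff (a + b) = x.coeff a * y.coeff b := by
  rw [HahnSeries.coeff_mul, Finset.sum_eq_single (a, b)]
  · rintro ⟨i, j⟩ hij hne
    rw [Finset.mem_antidiagonal] at hij
    obtain ⟨-, -, hsum⟩ := hij
    rcases lt_trichotomy i a with h | h | h
    · simp [hx i h]
    · exact absurd (Prod.ext h (by simp only at hsum ⊢; omega)) hne
    · simp only at hsum
      simp [hy j (by omega)]
  · intro h
    rw [Finset.mem_antidiagonal] at h
    simp only [HahnSeries.mem_support, and_true, not_and_or, not_not] at h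
    rcases h with h | h <;> simp [h]

/-- Matrix form of `coeff_mul_add_of_forall_lt`. -/
theorem specComp_mul_add_of_forall_lt {p q r : ℕ}
    {G : Matrix (Fin p) (Fin q) (LaurentSeries ℝ)} {H : Matrix (Fin q) (Fin r) (LaurentSeries ℝ)}
    {a b : ℤ} (hG : ∀ k < a, specComp k G = 0) (hH : ∀ k < b, specComp k H = 0) :
    specComp (a + b) (G * H) = specComp a G * specComp b H := by
  ext i j
  simp only [specComp, Matrix.of_apply, Matrix.mul_apply, HahnSeries.coeff_sum]
  exact Finset.sum_congr rfl fun l _ => coeff_mul_add_of_forall_lt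
    (fun k hk => congrFun₂ (hG k hk) i l) (fun k hk => congrFun₂ (hH k hk) l j)

theorem StrictlyProper.specComp_eq_zero {p q : ℕ} {G : Matrix (Fin p) (Fin q) (LaurentSeries ℝ)}
    (hG : StrictlyProper G) {k : ℤ} (hk : k ≤ 0) : specComp k G = 0 := by
  ext i j
  exact hG i j k hk

theorem specComp_sub {p q : ℕ} (k : ℤ) (G H : Matrix (Fin p) (Fin q) (LaurentSeries ℝ)) :
    specComp k (G - H) = specComp k G - specComp k H := by
  ext i j
  simp [specComp]

theorem specComp_liftL_mul {p q r : ℕ} (k : ℤ) (M : Matrix (Fin p) (Fin q) ℝ)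
    (G : Matrix (Fin q) (Fin r) (LaurentSeries ℝ)) :
    specComp k (liftL M * G) = M * specComp k G := by
  ext i j
  simp [specComp, liftL, Matrix.mul_apply, HahnSeries.coeff_sum,
    HahnSeries.algebraMap_apply',
    HahnSeries.C_apply]

/-- Multiplication by `z = w⁻¹` shifts the spectral components by one. -/
theorem specComp_scalar_wvar_inv_mul {p q : ℕ} (k : ℤ)
    (G : Matrix (Fin p) (Fin q) (LaurentSeries ℝ)) :
    specComp k (Matrix.scalar (Fin p) wvar⁻¹ * G) = specComp (k + 1) G := by
  ext i j
  simp [specComp, wvar, HahnSeries.inv_single, HahnSeries.coeff_single_mul]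

/-- If strictly proper `(Rc, Mc)` with `Rc(1) = I` are implementation matrices for strictly
proper closed-loop maps `(Φx, Φu)`, i.e. `Rc = Φx Δc` and `Mc = Φu Δc` with
`Δc = (w⁻¹ I − A) Rc − B Mc`, then the first spectral components of `Mc` and `Φu` agree:
`Mc(1) = Φu(1)`. -/
theorem first_spectral_component_eq {n m : ℕ}
    (A : Matrix (Fin n) (Fin n) ℝ) (B : Matrix (Fin n) (Fin m) ℝ)
    (Φx Rc : Matrix (Fin n) (Fin n) (LaurentSeries ℝ))
    (Φu Mc : Matrix (Fin m) (Fin n) (LaurentSeries ℝ))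
    (hΦx : StrictlyProper Φx) (hΦu : StrictlyProper Φu)
    (hRc : StrictlyProper Rc) (hMc : StrictlyProper Mc)
    (hRc1 : specComp 1 Rc = 1)
    (hR : Rc = Φx * ((Matrix.scalar (Fin n) wvar⁻¹ - liftL A) * Rc - liftL B * Mc))
    (hM : Mc = Φu * ((Matrix.scalar (Fin n) wvar⁻¹ - liftL A) * Rc - liftL B * Mc)) :
    specComp 1 Mc = specComp 1 Φu := by
  set Δ := (Matrix.scalar (Fin n) wvar⁻¹ - liftL A) * Rc - liftL B * Mc with hΔ
  have hcomp (k : ℤ) (hk : k ≤ 0) : specComp k Δ = specComp (k + 1) Rc := by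
    rw [hΔ, sub_mul, specComp_sub, specComp_sub, specComp_scalar_wvar_inv_mul,
      specComp_liftL_mul, specComp_liftL_mul, hRc.specComp_eq_zero hk, hMc.specComp_eq_zero hk]
    simp
  have hneg (k : ℤ) (hk : k < 0) : specComp k Δ = 0 := by
    rw [hcomp k hk.le, hRc.specComp_eq_zero (by omega)]
  have hzero : specComp 0 Δ = 1 := by
    rw [hcomp 0 le_rfl, zero_add, hRc1]
  have hmul := specComp_mul_add_of_forall_lt (a := 1) (b := 0)
    (fun k hk => hΦu.specComp_eq_zero (Int.lt_add_one_iff.mp hk)) hneg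
  rw [hzero, Matrix.mul_one, add_zero, ← hM] at hmul
  exact hmul
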